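/- arXiv:2001.02992 — 3 statements merged into one kernel-verified Lean document; each statement's English description precedes it below -/
import Mathlib

section
/- Let 𝒳 be a nonempty finite set, P_𝒳 a probability measure on 𝒳, P_ℱ a probability measure on the set of functions 𝒳 → {−1,1}, and m ≥ 1. Let (X,F) ∼ P_𝒳 × P_ℱ, Y = F(X), g : 𝒳 × {−1,1} → [m], and W = g(X,Y). Then E_F[ ∑_{i∈[m]} (P(W = i | F) − P(W = i))² ] ≤ √(CP(P_𝒳, P_ℱ)). -/
open Finset

/-- Cross-predictability of a distribution `pF` on sign-valued functions with respect to an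
input distribution `pX` on a finite set `𝒳`. Signs are encoded as `ℤˣ = {±1}`. -/
noncomputable def cp {𝒳 : Type*} [Fintype 𝒳] [DecidableEq 𝒳] (pX : 𝒳 → ℝ)
    (pF : (𝒳 → ℤˣ) → ℝ) : ℝ :=
  ∑ F : 𝒳 → ℤˣ, ∑ F' : 𝒳 → ℤˣ, pF F * pF F' *
    (∑ x : 𝒳, pX x * (((F x : ℤ) : ℝ) * ((F' x : ℤ) : ℝ))) ^ 2

/-- The second-moment kernel `(x, x') ↦ E_F[F(x) F(x')]`. -/
noncomputable def signKernel {𝒳 : Type*} [Fintype 𝒳] [DecidableEq 𝒳]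
    (pF : (𝒳 → ℤˣ) → ℝ) (x x' : 𝒳) : ℝ :=
  ∑ F : 𝒳 → ℤˣ, pF F * (((F x : ℤ) : ℝ) * ((F x' : ℤ) : ℝ))

/-- Cross-predictability is the squared Hilbert–Schmidt norm of the second-moment kernel. -/
theorem cp_eq_sum_signKernel_sq {𝒳 : Type*} [Fintype 𝒳] [DecidableEq 𝒳] (pX : 𝒳 → ℝ)
    (pF : (𝒳 → ℤˣ) → ℝ) :
    cp pX pF = ∑ x, ∑ x', pX x * pX x' * signKernel pF x x' ^ 2 := by
  have hl : cp pX pF = ∑ a : (𝒳 → ℤˣ) × (𝒳 → ℤˣ), ∑ b : 𝒳 × 𝒳, pF a.1 * pF a.2 *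
      ((pX b.1 * (((a.1 b.1 : ℤ) : ℝ) * ((a.2 b.1 : ℤ) : ℝ))) *
        (pX b.2 * (((a.1 b.2 : ℤ) : ℝ) * ((a.2 b.2 : ℤ) : ℝ)))) := by
    simp only [cp, Fintype.sum_prod_type, sq, sum_mul_sum]
    simp only [mul_sum]
  have hr : ∑ x, ∑ x', pX x * pX x' * signKernel pF x x' ^ 2 =
      ∑ b : 𝒳 × 𝒳, ∑ a : (𝒳 → ℤˣ) × (𝒳 → ℤˣ), pX b.1 * pX b.2 *
      ((pF a.1 * (((a.1 b.1 : ℤ) : ℝ) * ((a.1 b.2 : ℤ) : ℝ))) *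
        (pF a.2 * (((a.2 b.1 : ℤ) : ℝ) * ((a.2 b.2 : ℤ) : ℝ)))) := by
    simp only [signKernel, Fintype.sum_prod_type, sq, sum_mul_sum]
    simp only [mul_sum]
  rw [hl, hr, sum_comm]
  exact sum_congr rfl fun b _ => sum_congr rfl fun a _ => by ring

/-- The variance of a finitely supported real random variable is at most its second moment
about any point `c`. -/
theorem sum_mul_sub_mean_sq_le {ι : Type*} [Fintype ι] (p : ι → ℝ) (hp : ∑ j, p j = 1)
    (f : ι → ℝ) (c : ℝ) :
    ∑ j, p j * (f j - ∑ k, p k * f k) ^ 2 ≤ ∑ j, p j * (f j - c) ^ 2 := by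
  set μ := ∑ k, p k * f k with hμ
  have expand (t : ℝ) :
      ∑ j, p j * (f j - t) ^ 2 = ∑ j, p j * f j ^ 2 - 2 * t * μ + t ^ 2 := by
    have h (j : ι) : p j * (f j - t) ^ 2
        = p j * f j ^ 2 - 2 * t * (p j * f j) + t ^ 2 * p j := by ring
    simp only [h, sum_add_distrib, sum_sub_distrib, ← mul_sum, hp, ← hμ, mul_one]
  rw [expand, expand]
  nlinarith [sq_nonneg (μ - c)]

/-- A kernel bounded by one in absolute value pairs with the second-moment kernel to at most
the square root of the cross-predictability. -/
theorem sum_signKernel_mul_le_sqrt_cp {𝒳 : Type*} [Fintype 𝒳] [DecidableEq 𝒳]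
    (pX : 𝒳 → ℝ) (hpX0 : ∀ x, 0 ≤ pX x) (hpX1 : ∑ x : 𝒳, pX x = 1)
    (pF : (𝒳 → ℤˣ) → ℝ) (K : 𝒳 → 𝒳 → ℝ) (hK : ∀ x x', K x x' ^ 2 ≤ 1) :
    ∑ x, ∑ x', pX x * pX x' * (signKernel pF x x' * K x x') ≤ Real.sqrt (cp pX pF) := by
  apply Real.le_sqrt_of_sq_le
  rw [cp_eq_sum_signKernel_sq]
  simp only [← Fintype.sum_prod_type']
  have hw (b : 𝒳 × 𝒳) : 0 ≤ pX b.1 * pX b.2 := mul_nonneg (hpX0 _) (hpX0 _)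
  have hw1 : ∑ b : 𝒳 × 𝒳, pX b.1 * pX b.2 = 1 := by
    rw [Fintype.sum_prod_type, ← sum_mul_sum, hpX1, one_mul]
  calc _ ≤ (∑ b : 𝒳 × 𝒳, pX b.1 * pX b.2 * signKernel pF b.1 b.2 ^ 2) *
        ∑ b : 𝒳 × 𝒳, pX b.1 * pX b.2 * K b.1 b.2 ^ 2 :=
        sum_sq_le_sum_mul_sum_of_sq_le_mul _
          (fun b _ => mul_nonneg (hw b) (sq_nonneg _))
          (fun b _ => mul_nonneg (hw b) (sq_nonneg _)) (fun b _ => le_of_eq (by ring))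
    _ ≤ (∑ b : 𝒳 × 𝒳, pX b.1 * pX b.2 * signKernel pF b.1 b.2 ^ 2) * 1 := by
        refine mul_le_mul_of_nonneg_left ?_
          (sum_nonneg fun b _ => mul_nonneg (hw b) (sq_nonneg _))
        rw [← hw1]
        exact sum_le_sum fun b _ => mul_le_of_le_one_right (hw b) (hK _ _)
    _ = _ := mul_one _

/-- The coefficient of `y` in the affine expansion of `y ↦ 1[g(x,y) = i]` on `{±1}`. -/
noncomputable def signCoeff {𝒳 κ : Type*} [DecidableEq κ] (g : 𝒳 × ℤˣ → κ) (i : κ) (x : 𝒳) :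
    ℝ :=
  ((if g (x, 1) = i then 1 else 0) - (if g (x, -1) = i then 1 else 0)) / 2

theorem indicator_eq_add_signCoeff_mul {𝒳 κ : Type*} [DecidableEq κ] (g : 𝒳 × ℤˣ → κ) (i : κ)
    (x : 𝒳) (y : ℤˣ) :
    (if g (x, y) = i then (1 : ℝ) else 0) =
      ((if g (x, 1) = i then 1 else 0) + (if g (x, -1) = i then 1 else 0)) / 2 +
        signCoeff g i x * ((y : ℤ) : ℝ) := by
  rcases Int.units_eq_one_or y with rfl | rfl <;> simp [signCoeff] <;> ring

theorem sum_signCoeff_sq_le_one {𝒳 κ : Type*} [Fintype κ] [DecidableEq κ] (g : 𝒳 × ℤˣ → κ)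
    (x : 𝒳) : ∑ i, signCoeff g i x ^ 2 ≤ 1 := by
  calc ∑ i, signCoeff g i x ^ 2
      ≤ ∑ i, ((if g (x, 1) = i then 1 else 0) + (if g (x, -1) = i then 1 else 0)) / 2 := by
        refine sum_le_sum fun i _ => ?_
        unfold signCoeff
        split_ifs <;> norm_num
    _ = (1 : ℝ) := by
        rw [← sum_div, sum_add_distrib]
        simp

theorem sum_signCoeff_mul_sq_le_one {𝒳 κ : Type*} [Fintype κ] [DecidableEq κ]
    (g : 𝒳 × ℤˣ → κ) (x x' : 𝒳) :
    (∑ i, signCoeff g i x * signCoeff g i x') ^ 2 ≤ 1 :=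
  (sum_mul_sq_le_sq_mul_sq _ _ _).trans <|
    mul_le_one₀ (sum_signCoeff_sq_le_one g x) (sum_nonneg fun _ _ => sq_nonneg _)
      (sum_signCoeff_sq_le_one g x')

/-- The expected square of the linear statistic `F ↦ E_X[b(X) F(X)]`, through the second-moment
kernel. -/
theorem sum_mul_linear_sq_eq {𝒳 : Type*} [Fintype 𝒳] [DecidableEq 𝒳] (pX : 𝒳 → ℝ)
    (pF : (𝒳 → ℤˣ) → ℝ) (b : 𝒳 → ℝ) :
    ∑ F : 𝒳 → ℤˣ, pF F * (∑ x, pX x * (b x * ((F x : ℤ) : ℝ))) ^ 2 =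
      ∑ x, ∑ x', pX x * pX x' * (signKernel pF x x' * (b x * b x')) := by
  simp only [signKernel, sq, mul_sum, sum_mul]
  rw [sum_comm]
  refine sum_congr rfl fun x _ => ?_
  rw [sum_comm]
  exact sum_congr rfl fun x' _ => sum_congr rfl fun F _ => by ring

/-- for `(X,F) ∼ P_𝒳 × P_ℱ`, `Y = F(X)`, `g : 𝒳 × {±1} → [m]`, `W = g(X,Y)`:
`E_F[∑_{i∈[m]} (P(W=i|F) − P(W=i))²] ≤ √CP(P_𝒳,P_ℱ)`.
Here `PWc i F = P(W=i|F)` and `PW i = P(W=i)`. -/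
theorem m_values_information_bound {𝒳 : Type*} [Fintype 𝒳] [DecidableEq 𝒳] [Nonempty 𝒳]
    (pX : 𝒳 → ℝ) (hpX0 : ∀ x, 0 ≤ pX x) (hpX1 : ∑ x : 𝒳, pX x = 1)
    (pF : (𝒳 → ℤˣ) → ℝ) (hpF0 : ∀ F, 0 ≤ pF F) (hpF1 : ∑ F : 𝒳 → ℤˣ, pF F = 1)
    (m : ℕ) (hm : 1 ≤ m) (g : 𝒳 × ℤˣ → Fin m)
    (PWc : Fin m → (𝒳 → ℤˣ) → ℝ)
    (hPWc : ∀ i F, PWc i F = ∑ x : 𝒳, pX x * (if g (x, F x) = i then (1 : ℝ) else 0))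
    (PW : Fin m → ℝ) (hPW : ∀ i, PW i = ∑ F : 𝒳 → ℤˣ, pF F * PWc i F) :
    ∑ F : 𝒳 → ℤˣ, pF F * ∑ i : Fin m, (PWc i F - PW i) ^ 2
      ≤ Real.sqrt (cp pX pF) := by
  have hvar (i : Fin m) : ∑ F : 𝒳 → ℤˣ, pF F * (PWc i F - PW i) ^ 2 ≤
      ∑ x, ∑ x', pX x * pX x' *
        (signKernel pF x x' * (signCoeff g i x * signCoeff g i x')) := by
    rw [hPW i, ← sum_mul_linear_sq_eq]
    refine (sum_mul_sub_mean_sq_le pF hpF1 (PWc i) (∑ x, pX x *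
      (((if g (x, 1) = i then 1 else 0) + (if g (x, -1) = i then 1 else 0)) / 2))).trans_eq ?_
    refine sum_congr rfl fun F _ => ?_
    rw [hPWc, ← sum_sub_distrib]
    simp only [← mul_sub, indicator_eq_add_signCoeff_mul g i _ (F _), add_sub_cancel_left]
  calc ∑ F : 𝒳 → ℤˣ, pF F * ∑ i : Fin m, (PWc i F - PW i) ^ 2
      = ∑ i : Fin m, ∑ F : 𝒳 → ℤˣ, pF F * (PWc i F - PW i) ^ 2 := by
        simp only [mul_sum]
        exact sum_comm
    _ ≤ ∑ i : Fin m, ∑ x, ∑ x', pX x * pX x' *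
          (signKernel pF x x' * (signCoeff g i x * signCoeff g i x')) :=
        sum_le_sum fun i _ => hvar i
    _ = ∑ x, ∑ x', pX x * pX x' *
          (signKernel pF x x' * ∑ i, signCoeff g i x * signCoeff g i x') := by
        simp only [mul_sum]
        rw [sum_comm]
        exact sum_congr rfl fun x _ => sum_comm
    _ ≤ Real.sqrt (cp pX pF) :=
        sum_signKernel_mul_le_sqrt_cp pX hpX0 hpX1 pF _ (sum_signCoeff_mul_sq_le_one g)
end

section
/- Let n, m ≥ 1. Let P_𝒳 be the uniform measure on {−1,1}^n and P_ℱ the uniform measure on the set of all 2^n parity functions {p_s : s ⊆ [n]}. Let (X,F) ∼ P_𝒳 × P_ℱ, Y = F(X), g : {−1,1}^n × {−1,1} → [m], and W = g(X,Y). Then (i) ∑_{i∈[m]} ∑_{s⊆[n]} (P(W = i, F = p_s) − P(W = i)·P(F = p_s))² ≤ 2^{−3n/2}, and (ii) ∑_{i∈[m]} ∑_{s⊆[n]} |P(W = i, F = p_s) − P(W = i)·P(F = p_s)| ≤ √m · 2^{−n/4}. -/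
open Finset

/-- Orthogonality of the parity functions, summed over the index set. -/
theorem sum_parity_mul_parity {n : ℕ} (x y : Fin n → ℤˣ) :
    ∑ s : Finset (Fin n), (((∏ j ∈ s, x j : ℤˣ) : ℤ) : ℝ) * (((∏ j ∈ s, y j : ℤˣ) : ℤ) : ℝ)
      = if x = y then (2 : ℝ) ^ n else 0 := by
  have key : ∑ s : Finset (Fin n),
      (((∏ j ∈ s, x j : ℤˣ) : ℤ) : ℝ) * (((∏ j ∈ s, y j : ℤˣ) : ℤ) : ℝ)
      = ∏ j : Fin n, (1 + (((x j * y j : ℤˣ) : ℤ) : ℝ)) := by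
    rw [Finset.prod_one_add, Finset.powerset_univ]
    refine Finset.sum_congr rfl fun s _ => ?_
    push_cast
    rw [Finset.prod_mul_distrib]
  rw [key]
  split_ifs with h
  · subst h
    simp only [← sq, Int.units_sq]
    norm_num
  · obtain ⟨j, hj⟩ := Function.ne_iff.mp h
    refine Finset.prod_eq_zero (Finset.mem_univ j) ?_
    rcases Int.units_eq_one_or (x j) with hx | hx <;>
      rcases Int.units_eq_one_or (y j) with hy | hy <;> simp_all

/-- Parseval's identity for the (unnormalized) Fourier coefficients on `{−1,1}^n`. -/
theorem sum_sq_sum_mul_parity {n : ℕ} (b : (Fin n → ℤˣ) → ℝ) :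
    ∑ s : Finset (Fin n), (∑ x, b x * (((∏ j ∈ s, x j : ℤˣ) : ℤ) : ℝ)) ^ 2
      = 2 ^ n * ∑ x, b x ^ 2 := by
  calc _ = ∑ x, ∑ y, b x * b y * ∑ s : Finset (Fin n),
        (((∏ j ∈ s, x j : ℤˣ) : ℤ) : ℝ) * (((∏ j ∈ s, y j : ℤˣ) : ℤ) : ℝ) := by
        simp_rw [sq, Finset.sum_mul_sum, Finset.mul_sum]
        rw [Finset.sum_comm]
        refine Finset.sum_congr rfl fun x _ => ?_
        rw [Finset.sum_comm]
        refine Finset.sum_congr rfl fun y _ => Finset.sum_congr rfl fun s _ => ?_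
        ring
    _ = _ := by
        simp_rw [sum_parity_mul_parity, Finset.mul_sum]
        refine Finset.sum_congr rfl fun x _ => ?_
        simp only [mul_ite, mul_zero, Finset.sum_ite_eq, Finset.mem_univ, if_true]
        ring

/-- The mean minimizes the sum of squared deviations. -/
theorem sum_sq_sub_mean_le {ι : Type*} [Fintype ι] (f : ι → ℝ) (a μ : ℝ)
    (hμ : Fintype.card ι * μ = ∑ i, f i) :
    ∑ i, (f i - μ) ^ 2 ≤ ∑ i, (f i - a) ^ 2 := by
  have expand : ∀ c : ℝ, ∑ i, (f i - c) ^ 2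
      = ∑ i, f i ^ 2 - 2 * c * ∑ i, f i + Fintype.card ι * c ^ 2 := fun c => by
    simp only [sub_sq, Finset.sum_add_distrib, Finset.sum_sub_distrib, Finset.mul_sum,
      Finset.sum_const, Finset.card_univ, nsmul_eq_mul]
    congr 2
    exact Finset.sum_congr rfl fun i _ => by ring
  rw [expand, expand, ← hμ]
  nlinarith [mul_nonneg (Nat.cast_nonneg (α := ℝ) (Fintype.card ι)) (sq_nonneg (a - μ))]

/-- A function of a sign, written as its even part plus its odd part. -/
theorem eq_even_part_add_odd_part_mul (f : ℤˣ → ℝ) (u : ℤˣ) :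
    f u = (f 1 + f (-1)) / 2 + (f 1 - f (-1)) / 2 * ((u : ℤ) : ℝ) := by
  rcases Int.units_eq_one_or u with rfl | rfl <;> push_cast <;> ring

/-- Half the difference of two point masses has squared `ℓ²` norm at most one. -/
theorem sum_sq_half_sub_indicator_le_one {α : Type*} [Fintype α] [DecidableEq α] (a b : α) :
    ∑ i, (((if a = i then (1 : ℝ) else 0) - (if b = i then 1 else 0)) / 2) ^ 2 ≤ 1 := by
  calc _ ≤ ∑ i, ((if a = i then (1 : ℝ) else 0) + (if b = i then 1 else 0)) / 2 := by
        refine Finset.sum_le_sum fun i _ => ?_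
        split_ifs <;> norm_num
    _ = 1 := by
        rw [← Finset.sum_div, Finset.sum_add_distrib]
        simp

/-- `P_𝒳` uniform on `{−1,1}^n`, `P_ℱ` uniform on all `2^n` parity functions
`p_s`, `g : {−1,1}^n × {−1,1} → [m]`, `W = g(X, F(X))`. Then
(i) `∑_{i∈[m]} ∑_{s⊆[n]} (P(W=i, F=p_s) − P(W=i)P(F=p_s))² ≤ 2^{−3n/2}`, and
(ii) `∑_{i∈[m]} ∑_{s⊆[n]} |P(W=i, F=p_s) − P(W=i)P(F=p_s)| ≤ √m · 2^{−n/4}`.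
Here `PWc i s = P(W=i | F=p_s)`, `P(F=p_s) = 2^{−n}`, `P(W=i,F=p_s) = 2^{−n}·PWc i s`,
and `PW i = P(W=i) = ∑_s 2^{−n}·PWc i s` (signs encoded as `ℤˣ = {±1}`). -/
theorem parity_joint_distribution_bounds (n m : ℕ) (hn : 1 ≤ n) (hm : 1 ≤ m)
    (g : (Fin n → ℤˣ) × ℤˣ → Fin m)
    (PWc : Fin m → Finset (Fin n) → ℝ)
    (hPWc : ∀ i s, PWc i s
      = ∑ x : Fin n → ℤˣ, (1 / 2 ^ n : ℝ) * (if g (x, ∏ j ∈ s, x j) = i then 1 else 0))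
    (PW : Fin m → ℝ) (hPW : ∀ i, PW i = ∑ s : Finset (Fin n), (1 / 2 ^ n : ℝ) * PWc i s) :
    (∑ i : Fin m, ∑ s : Finset (Fin n),
        ((1 / 2 ^ n : ℝ) * PWc i s - PW i * (1 / 2 ^ n)) ^ 2
      ≤ (2 : ℝ) ^ (-(3 * (n : ℝ)) / 2)) ∧
    (∑ i : Fin m, ∑ s : Finset (Fin n),
        |(1 / 2 ^ n : ℝ) * PWc i s - PW i * (1 / 2 ^ n)|
      ≤ Real.sqrt m * (2 : ℝ) ^ (-(n : ℝ) / 4)) := by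
  have hN : (0 : ℝ) < 2 ^ n := by positivity
  set N : ℝ := 2 ^ n with hNdef
  have hrow : ∀ i, ∑ s : Finset (Fin n), ((1 / N) * PWc i s - PW i * (1 / N)) ^ 2
      ≤ (1 / N) ^ 3 * ∑ x : Fin n → ℤˣ,
        (((if g (x, 1) = i then (1 : ℝ) else 0) - (if g (x, -1) = i then 1 else 0)) / 2) ^ 2 := by
    intro i
    set b : (Fin n → ℤˣ) → ℝ := fun x =>
      ((if g (x, 1) = i then (1 : ℝ) else 0) - (if g (x, -1) = i then 1 else 0)) / 2 with hb
    let a : ℝ := (1 / N) * ∑ x : Fin n → ℤˣ,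
      ((if g (x, 1) = i then (1 : ℝ) else 0) + (if g (x, -1) = i then 1 else 0)) / 2
    have hfourier : ∀ s, PWc i s - a
        = (1 / N) * ∑ x, b x * (((∏ j ∈ s, x j : ℤˣ) : ℤ) : ℝ) := fun s => by
      rw [hPWc, ← Finset.mul_sum, ← mul_sub, ← Finset.sum_sub_distrib]
      congr 1
      refine Finset.sum_congr rfl fun x _ => ?_
      rw [eq_even_part_add_odd_part_mul (fun u => if g (x, u) = i then (1 : ℝ) else 0)]
      simp only [hb]
      ring
    have hmean : (Fintype.card (Finset (Fin n)) : ℝ) * PW i = ∑ s, PWc i s := by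
      rw [hPW, ← Finset.mul_sum, Fintype.card_finset, Fintype.card_fin]
      push_cast
      rw [← hNdef]
      field_simp
    calc ∑ s : Finset (Fin n), ((1 / N) * PWc i s - PW i * (1 / N)) ^ 2
        = (1 / N) ^ 2 * ∑ s, (PWc i s - PW i) ^ 2 := by
          rw [Finset.mul_sum]
          exact Finset.sum_congr rfl fun s _ => by ring
      _ ≤ (1 / N) ^ 2 * ∑ s, (PWc i s - a) ^ 2 := by
          exact mul_le_mul_of_nonneg_left (sum_sq_sub_mean_le _ _ _ hmean) (by positivity)
      _ = (1 / N) ^ 3 * ∑ x, b x ^ 2 := by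
          simp_rw [hfourier, mul_pow]
          rw [← Finset.mul_sum, sum_sq_sum_mul_parity, ← hNdef]
          field_simp
  have hsq : ∑ i : Fin m, ∑ s : Finset (Fin n), ((1 / N) * PWc i s - PW i * (1 / N)) ^ 2
      ≤ (2 : ℝ) ^ (-(3 * (n : ℝ)) / 2) := by
    calc _ ≤ (1 / N) ^ 3 * ∑ x : Fin n → ℤˣ, ∑ i : Fin m,
          (((if g (x, 1) = i then (1 : ℝ) else 0) - (if g (x, -1) = i then 1 else 0)) / 2) ^ 2 := by
          rw [Finset.sum_comm (s := (Finset.univ : Finset (Fin n → ℤˣ))), Finset.mul_sum]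
          exact Finset.sum_le_sum fun i _ => hrow i
      _ ≤ (1 / N) ^ 3 * ∑ _x : Fin n → ℤˣ, 1 := by
          gcongr
          exact sum_sq_half_sub_indicator_le_one _ _
      _ = (2 : ℝ) ^ (-(2 * (n : ℝ))) := by
          have hcard : ∑ _x : Fin n → ℤˣ, (1 : ℝ) = N := by simp [hNdef]
          rw [hcard, Real.rpow_neg zero_le_two, mul_comm (2 : ℝ), Real.rpow_mul zero_le_two,
            Real.rpow_natCast, ← hNdef, Real.rpow_two]
          field_simp
      _ ≤ _ := by
          apply Real.rpow_le_rpow_of_exponent_le one_le_two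
          linarith [Nat.cast_nonneg (α := ℝ) n]
  refine ⟨hsq, ?_⟩
  rw [← Fintype.sum_prod_type'] at hsq ⊢
  refine abs_le_of_sq_le_sq' ?_ (by positivity) |>.2
  calc _ ≤ ((Finset.univ : Finset (Fin m × Finset (Fin n))).card : ℝ) * ∑ p : Fin m × Finset (Fin n),
        |(1 / N) * PWc p.1 p.2 - PW p.1 * (1 / N)| ^ 2 := sq_sum_le_card_mul_sum_sq
    _ ≤ (m * N) * (2 : ℝ) ^ (-(3 * (n : ℝ)) / 2) := by
        simp only [sq_abs, Finset.card_univ, Fintype.card_prod, Fintype.card_finset,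
          Fintype.card_fin]
        push_cast
        gcongr
    _ = _ := by
        rw [mul_pow, Real.sq_sqrt (Nat.cast_nonneg m), mul_assoc, hNdef, ← Real.rpow_natCast 2 n,
          ← Real.rpow_add two_pos, ← Real.rpow_mul_natCast zero_le_two]
        congr 2
        push_cast
        ring
end

section
/- Let 𝒳 be a nonempty finite set, P_𝒳 a probability measure on 𝒳, and P_ℱ a probability measure on the set of functions 𝒳 → {−1,1}. Let D_⋆ = P_𝒳 ⊗ Unif{−1,1} on 𝒳 × {−1,1}, and for a function f : 𝒳 → {−1,1} let D_f be the law of (X, f(X)) with X ∼ P_𝒳. Then for every g : 𝒳 × {−1,1} → ℝ, E_{F∼P_ℱ}[ (E_{Z∼D_F}[g(Z)] − E_{Z∼D_⋆}[g(Z)])² ] ≤ E_{Z∼D_⋆}[g²(Z)] · √(CP(P_𝒳, P_ℱ)). -/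
open Finset

/-- Cauchy–Schwarz inequality for finite sums with nonnegative weights. -/
theorem sq_weighted_sum_mul_le {ι : Type*} (s : Finset ι) {w : ι → ℝ} (hw : ∀ i, 0 ≤ w i)
    (a b : ι → ℝ) :
    (∑ i ∈ s, w i * (a i * b i)) ^ 2 ≤ (∑ i ∈ s, w i * a i ^ 2) * ∑ i ∈ s, w i * b i ^ 2 :=
  sum_sq_le_sum_mul_sum_of_sq_le_mul s (fun i _ => mul_nonneg (hw i) (sq_nonneg _))
    (fun i _ => mul_nonneg (hw i) (sq_nonneg _)) (fun i _ => le_of_eq (by ring))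

/-- The mean squared correlation of `h` with a random function `φ F` is at most the second moment
of `h` times the root mean square of the correlation of two independent copies of `φ F`. -/
theorem weighted_sum_sq_correlation_le {ι α : Type*} [Fintype ι] [Fintype α]
    {p : α → ℝ} (hp : ∀ x, 0 ≤ p x) {q : ι → ℝ} (hq : ∀ F, 0 ≤ q F)
    (φ : ι → α → ℝ) (h : α → ℝ) :
    ∑ F, q F * (∑ x, p x * (h x * φ F x)) ^ 2 ≤
      (∑ x, p x * h x ^ 2) *
        Real.sqrt (∑ F, ∑ F', q F * q F' * (∑ x, p x * (φ F x * φ F' x)) ^ 2) := by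
  set a : ι → ℝ := fun F => ∑ x, p x * (h x * φ F x) with ha
  set S := ∑ F, q F * a F ^ 2 with hS
  set H := ∑ x, p x * h x ^ 2
  set C := ∑ F, ∑ F', q F * q F' * (∑ x, p x * (φ F x * φ F' x)) ^ 2 with hC
  set Q := ∑ x, p x * (∑ F, q F * (a F * φ F x)) ^ 2 with hQ
  have hS0 : 0 ≤ S := sum_nonneg fun F _ => mul_nonneg (hq F) (sq_nonneg _)
  have hH0 : 0 ≤ H := sum_nonneg fun x _ => mul_nonneg (hp x) (sq_nonneg _)
  have hC0 : 0 ≤ C := sum_nonneg fun F _ => sum_nonneg fun F' _ =>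
    mul_nonneg (mul_nonneg (hq F) (hq F')) (sq_nonneg _)
  have hS_eq : S = ∑ x, p x * (h x * ∑ F, q F * (a F * φ F x)) := by
    calc S = ∑ F, ∑ x, p x * (h x * (q F * (a F * φ F x))) := by
          refine sum_congr rfl fun F _ => ?_
          rw [sq]
          nth_rewrite 2 [ha]
          simp only [mul_sum]
          exact sum_congr rfl fun x _ => by ring
      _ = _ := by
          rw [sum_comm]
          simp only [mul_sum]
  have hSQ : S ^ 2 ≤ H * Q := by
    rw [hS_eq]
    exact sq_weighted_sum_mul_le univ hp h _
  have hQ_eq : Q = ∑ z : ι × ι, q z.1 * q z.2 *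
      ((a z.1 * a z.2) * ∑ x, p x * (φ z.1 x * φ z.2 x)) := by
    rw [hQ, Fintype.sum_prod_type]
    simp only [sq, sum_mul_sum]
    simp only [mul_sum]
    rw [sum_comm]
    refine sum_congr rfl fun F _ => ?_
    rw [sum_comm]
    exact sum_congr rfl fun F' _ => sum_congr rfl fun x _ => by ring
  have hQC : Q ^ 2 ≤ S ^ 2 * C := by
    rw [hQ_eq]
    refine (sq_weighted_sum_mul_le univ (fun z : ι × ι => mul_nonneg (hq z.1) (hq z.2))
      (fun z : ι × ι => a z.1 * a z.2) _).trans_eq ?_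
    rw [hC, Fintype.sum_prod_type, Fintype.sum_prod_type, sq S, hS]
    congr 1
    rw [sum_mul_sum]
    exact sum_congr rfl fun F _ => sum_congr rfl fun F' _ => by ring
  have hQ_le : Q ≤ S * Real.sqrt C := by
    refine (abs_le_of_sq_le_sq' ?_ (by positivity)).2
    rwa [mul_pow, Real.sq_sqrt hC0]
  rcases hS0.eq_or_lt with h0 | hpos
  · rw [← h0]
    positivity
  · refine le_of_mul_le_mul_left ?_ hpos
    nlinarith [mul_le_mul_of_nonneg_left hQ_le hH0]

/-- with `D_⋆ = P_𝒳 ⊗ Unif{±1}` and `D_f` the law of `(X, f(X))`,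
for every `g : 𝒳 × {±1} → ℝ`:
`E_F[(E_{D_F}[g] − E_{D_⋆}[g])²] ≤ E_{D_⋆}[g²] · √CP(P_𝒳, P_ℱ)`. -/
theorem junk_vs_true_query_bound {𝒳 : Type*} [Fintype 𝒳] [DecidableEq 𝒳] [Nonempty 𝒳]
    (pX : 𝒳 → ℝ) (hpX0 : ∀ x, 0 ≤ pX x) (hpX1 : ∑ x : 𝒳, pX x = 1)
    (pF : (𝒳 → ℤˣ) → ℝ) (hpF0 : ∀ F, 0 ≤ pF F) (hpF1 : ∑ F : 𝒳 → ℤˣ, pF F = 1)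
    (g : 𝒳 × ℤˣ → ℝ) :
    ∑ F : 𝒳 → ℤˣ, pF F *
        ((∑ x : 𝒳, pX x * g (x, F x))
          - ∑ x : 𝒳, pX x * ((g (x, 1) + g (x, -1)) / 2)) ^ 2
      ≤ (∑ x : 𝒳, pX x * ((g (x, 1) ^ 2 + g (x, -1) ^ 2) / 2)) *
          Real.sqrt (cp pX pF) := by
  have hdiff : ∀ F : 𝒳 → ℤˣ, (∑ x : 𝒳, pX x * g (x, F x))
      - ∑ x : 𝒳, pX x * ((g (x, 1) + g (x, -1)) / 2)
      = ∑ x : 𝒳, pX x * ((g (x, 1) - g (x, -1)) / 2 * ((F x : ℤ) : ℝ)) := by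
    intro F
    rw [← sum_sub_distrib]
    refine sum_congr rfl fun x _ => ?_
    rcases Int.units_eq_one_or (F x) with hF | hF <;> rw [hF] <;> push_cast <;> ring
  simp only [hdiff]
  refine (weighted_sum_sq_correlation_le hpX0 hpF0 (fun F x => ((F x : ℤ) : ℝ)) _).trans ?_
  refine mul_le_mul_of_nonneg_right (sum_le_sum fun x _ => ?_) (Real.sqrt_nonneg _)
  refine mul_le_mul_of_nonneg_left ?_ (hpX0 x)
  nlinarith [sq_nonneg (g (x, 1) + g (x, -1))]
end
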